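/- Let G be an acyclically edge k-critical finite simple graph with k ≥ Δ(G) + 2, and let v be a vertex of G of degree 3. Then every neighbor of v has degree at least k − Δ(G) + 2. -/

import Mathlib

open SimpleGraph

/-- A proper edge coloring of `G`: distinct edges sharing a vertex get distinct colors. -/
def IsProperEdgeColoring {V : Type*} {α : Type*} (G : SimpleGraph V) (c : Sym2 V → α) : Prop :=
  ∀ e₁ ∈ G.edgeSet, ∀ e₂ ∈ G.edgeSet, e₁ ≠ e₂ → (∃ v, v ∈ e₁ ∧ v ∈ e₂) → c e₁ ≠ c e₂

/-- An acyclic edge coloring: proper, and no cycle of `G` uses at most two colors. -/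
def IsAcyclicEdgeColoring {V : Type*} {α : Type*} (G : SimpleGraph V) (c : Sym2 V → α) : Prop :=
  IsProperEdgeColoring G c ∧
    ∀ (v : V) (w : G.Walk v v), w.IsCycle →
      ¬ ∃ a b : α, ∀ e ∈ w.edges, c e = a ∨ c e = b

/-- `G` has an acyclic edge coloring with `k` colors. -/
def AcyclicEdgeColorable {V : Type*} (G : SimpleGraph V) (k : ℕ) : Prop :=
  ∃ c : Sym2 V → Fin k, IsAcyclicEdgeColoring G c

/-- The acyclic chromatic index: least `k` such that `G` is acyclically edge `k`-colorable. -/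
noncomputable def acyclicChromaticIndex {V : Type*} (G : SimpleGraph V) : ℕ :=
  sInf {k | AcyclicEdgeColorable G k}

/-- `G` is acyclically edge `k`-critical: `G` is not acyclically edge `k`-colorable, but every
proper subgraph of `G` is. -/
def IsAcyclicallyEdgeCritical {V : Type*} (G : SimpleGraph V) (k : ℕ) : Prop :=
  ¬ AcyclicEdgeColorable G k ∧ ∀ H : SimpleGraph V, H < G → AcyclicEdgeColorable H k

/-- The spanning subgraph of `G` whose edges have color `a` or `b`. -/
def colorSubgraph {V α : Type*} (G : SimpleGraph V) (c : Sym2 V → α) (a b : α) :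
    SimpleGraph V where
  Adj s t := G.Adj s t ∧ (c s(s, t) = a ∨ c s(s, t) = b)
  symm := ⟨fun s t h => by rw [Sym2.eq_swap]; exact ⟨h.1.symm, h.2⟩⟩
  loopless := ⟨fun s h => G.loopless.irrefl s h.1⟩

/-- The color `a` appears on an edge at `s`. -/
def ColorAt {V α : Type*} (G : SimpleGraph V) (c : Sym2 V → α) (s : V) (a : α) : Prop :=
  ∃ t, G.Adj s t ∧ c s(s, t) = a

section Coloring

variable {V α : Type*} {G H : SimpleGraph V} {c c' : Sym2 V → α} {a b : α}

theorem colorSubgraph_comm : colorSubgraph G c a b = colorSubgraph G c b a := by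
  ext s t
  simp [colorSubgraph, or_comm]

theorem isProperEdgeColoring_iff : IsProperEdgeColoring G c ↔
    ∀ s t t', G.Adj s t → G.Adj s t' → c s(s, t) = c s(s, t') → t = t' := by
  constructor
  · intro h s t t' ht ht' hc
    by_contra hne
    exact h s(s, t) ht s(s, t') ht' (mt Sym2.congr_right.1 hne) ⟨s, by simp, by simp⟩ hc
  · rintro h e₁ he₁ e₂ he₂ hne ⟨s, hs₁, hs₂⟩ hc
    obtain ⟨t, rfl⟩ := hs₁
    obtain ⟨t', rfl⟩ := hs₂
    exact hne (by rw [h s t t' he₁ he₂ hc])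

theorem isAcyclicEdgeColoring_iff : IsAcyclicEdgeColoring G c ↔
    IsProperEdgeColoring G c ∧ ∀ a b, (colorSubgraph G c a b).IsAcyclic := by
  refine and_congr_right fun _ => ⟨fun h a b v w hw => ?_, fun h v w hw => ?_⟩
  · have hle : colorSubgraph G c a b ≤ G := fun _ _ h => h.1
    refine h v (w.mapLe hle) (hw.mapLe hle) ⟨a, b, fun e he => ?_⟩
    rw [Walk.edges_mapLe_eq_edges] at he
    have := w.edges_subset_edgeSet he
    induction e with
    | h x y => exact this.2
  · rintro ⟨a, b, hab⟩
    have hw' : ∀ e ∈ w.edges, e ∈ (colorSubgraph G c a b).edgeSet := by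
      intro e he
      have h₁ := w.edges_subset_edgeSet he
      have h₂ := hab e he
      induction e with
      | h x y => exact ⟨h₁, h₂⟩
    exact h a b (w.transfer _ hw') (hw.transfer hw')

theorem IsAcyclicEdgeColoring.mono (h : IsAcyclicEdgeColoring G c) (hle : H ≤ G) :
    IsAcyclicEdgeColoring H c := by
  refine ⟨fun e₁ h₁ e₂ h₂ => h.1 e₁ (edgeSet_mono hle h₁) e₂ (edgeSet_mono hle h₂),
    fun v w hw hab => h.2 v (w.mapLe hle) (hw.mapLe hle) ?_⟩
  simpa only [Walk.edges_mapLe_eq_edges] using hab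

theorem IsAcyclicEdgeColoring.congr (h : IsAcyclicEdgeColoring G c)
    (hc : ∀ e ∈ G.edgeSet, c' e = c e) : IsAcyclicEdgeColoring G c' := by
  refine ⟨fun e₁ h₁ e₂ h₂ => ?_, fun v w hw => ?_⟩
  · rw [hc e₁ h₁, hc e₂ h₂]
    exact h.1 e₁ h₁ e₂ h₂
  · rintro ⟨a, b, hab⟩
    exact h.2 v w hw ⟨a, b, fun e he => hc e (w.edges_subset_edgeSet he) ▸ hab e he⟩

theorem colorSubgraph_congr (hc : ∀ e ∈ G.edgeSet, c' e = c e) :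
    colorSubgraph G c' a b = colorSubgraph G c a b := by
  ext s t
  exact and_congr_right fun h => by rw [hc _ h]

/-- A vertex that can reach another one in two colors but misses the first color
sees the second color. -/
theorem colorAt_of_reachable {s t : V} (hst : s ≠ t)
    (h : (colorSubgraph G c a b).Reachable s t) (ha : ¬ ColorAt G c s a) : ColorAt G c s b := by
  obtain ⟨p⟩ := h
  cases p with
  | nil => exact absurd rfl hst
  | cons h _ =>
    rcases h.2 with h' | h'
    · exact absurd ⟨_, h.1, h'⟩ ha
    · exact ⟨_, h.1, h'⟩

end Coloring

section Reachability

variable {V : Type*} {K : SimpleGraph V}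

theorem eq_of_isPath_of_subsingleton_neighbors
    (hK : ∀ s t₁ t₂ t₃, K.Adj s t₁ → K.Adj s t₂ → K.Adj s t₃ → t₁ = t₂ ∨ t₁ = t₃ ∨ t₂ = t₃)
    {x y : V} (hx : ∀ t₁ t₂, K.Adj x t₁ → K.Adj x t₂ → t₁ = t₂)
    (hy : ∀ t₁ t₂, K.Adj y t₁ → K.Adj y t₂ → t₁ = t₂)
    {w : V} (p : K.Walk w x) (q : K.Walk w y) (hp : p.IsPath) (hq : q.IsPath)
    (o : V) (ho : K.Adj w o) (hop : o ∉ p.support) (hoq : o ∉ q.support) : x = y := by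
  induction p generalizing o with
  | nil =>
    cases q with
    | nil => rfl
    | cons h q =>
      have := hx _ _ ho h
      subst this
      simp at hoq
  | cons h p ih =>
    cases q with
    | nil =>
      have := hy _ _ ho h
      subst this
      simp at hop
    | cons h' q =>
      rw [Walk.cons_isPath_iff] at hp hq
      rcases hK _ _ _ _ ho h h' with e | e | e
      · subst e
        simp at hop
      · subst e
        simp at hoq
      · subst e
        exact ih hx q hp.1 hq.1 _ h.symm hp.2 hq.2

/-- In a graph of maximum degree at most two, a component has at most two vertices of degree at
most one. -/
theorem eq_of_reachable_of_subsingleton_neighbors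
    (hK : ∀ s t₁ t₂ t₃, K.Adj s t₁ → K.Adj s t₂ → K.Adj s t₃ → t₁ = t₂ ∨ t₁ = t₃ ∨ t₂ = t₃)
    {u x y : V} (hu : ∀ t₁ t₂, K.Adj u t₁ → K.Adj u t₂ → t₁ = t₂)
    (hx : ∀ t₁ t₂, K.Adj x t₁ → K.Adj x t₂ → t₁ = t₂)
    (hy : ∀ t₁ t₂, K.Adj y t₁ → K.Adj y t₂ → t₁ = t₂)
    (hux : u ≠ x) (huy : u ≠ y) (h₁ : K.Reachable u x) (h₂ : K.Reachable u y) : x = y := by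
  obtain ⟨p, hp⟩ := h₁.exists_isPath
  obtain ⟨q, hq⟩ := h₂.exists_isPath
  cases p with
  | nil => exact absurd rfl hux
  | cons h p =>
    cases q with
    | nil => exact absurd rfl huy
    | cons h' q =>
      have := hu _ _ h h'
      subst this
      rw [Walk.cons_isPath_iff] at hp hq
      exact eq_of_isPath_of_subsingleton_neighbors hK hx hy p q hp.1 hq.1 _ h.symm hp.2 hq.2

theorem reachable_of_reachable_sup_edge {v s t : V} (hv : ∀ w, ¬ K.Adj v w) (htv : t ≠ v)
    (h : (K ⊔ edge v s).Reachable v t) : K.Reachable s t := by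
  obtain ⟨p⟩ := h
  suffices ∀ {w t} (p : (K ⊔ edge v s).Walk w t), (w = v ∨ K.Reachable s w) →
      t = v ∨ K.Reachable s t from (this p (.inl rfl)).resolve_left htv
  intro w t p
  induction p with
  | nil => exact id
  | @cons w w' _ h _ ih =>
    intro hw
    apply ih
    rcases h with h | h
    · rcases hw with rfl | hw
      · exact absurd h (hv _)
      · exact .inr (hw.trans h.reachable)
    · rw [edge_adj] at h
      rcases h.1 with ⟨rfl, rfl⟩ | ⟨rfl, rfl⟩
      · exact .inr .rfl
      · exact .inl rfl

theorem isAcyclic_sup_edge_sup_edge {v s t : V} (hK : K.IsAcyclic) (hv : ∀ w, ¬ K.Adj v w)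
    (hst : s ≠ v → t ≠ v → s ≠ t → ¬ K.Reachable s t) :
    (K ⊔ edge v s ⊔ edge v t).IsAcyclic := by
  have hone : ∀ w, (K ⊔ edge v w).IsAcyclic := by
    intro w
    by_cases hw : w = v
    · subst hw
      simpa using hK
    · apply hK.sup_edge_of_not_reachable
      rintro ⟨p⟩
      cases p with
      | nil => exact hw rfl
      | cons h _ => exact hv _ h
  by_cases ht : t = v
  · subst ht
    simpa using hone s
  by_cases hs : s = v
  · subst hs
    simpa using hone t
  by_cases h : s = t
  · subst h
    simpa [sup_assoc] using hone s
  exact (hone s).sup_edge_of_not_reachable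
    fun h' => hst hs ht h (reachable_of_reachable_sup_edge hv ht h')

end Reachability

section Coloring

variable {V α : Type*} {G : SimpleGraph V} {c : Sym2 V → α} {a b : α}

theorem eq_of_reachable_of_not_colorAt (hc : IsProperEdgeColoring G c) {u x y : V}
    (hu : ¬ ColorAt G c u a ∨ ¬ ColorAt G c u b) (hx : ¬ ColorAt G c x a ∨ ¬ ColorAt G c x b)
    (hy : ¬ ColorAt G c y a ∨ ¬ ColorAt G c y b) (hux : u ≠ x) (huy : u ≠ y)
    (h₁ : (colorSubgraph G c a b).Reachable u x)
    (h₂ : (colorSubgraph G c a b).Reachable u y) : x = y := by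
  rw [isProperEdgeColoring_iff] at hc
  have hend : ∀ z, (¬ ColorAt G c z a ∨ ¬ ColorAt G c z b) → ∀ t₁ t₂,
      (colorSubgraph G c a b).Adj z t₁ → (colorSubgraph G c a b).Adj z t₂ → t₁ = t₂ := by
    rintro z hz t₁ t₂ ⟨g₁, e₁⟩ ⟨g₂, e₂⟩
    apply hc z t₁ t₂ g₁ g₂
    rcases hz with hz | hz
    · rw [e₁.resolve_left fun h => hz ⟨_, g₁, h⟩, e₂.resolve_left fun h => hz ⟨_, g₂, h⟩]
    · rw [e₁.resolve_right fun h => hz ⟨_, g₁, h⟩, e₂.resolve_right fun h => hz ⟨_, g₂, h⟩]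
  refine eq_of_reachable_of_subsingleton_neighbors ?_ (hend u hu) (hend x hx) (hend y hy)
    hux huy h₁ h₂
  rintro s t₁ t₂ t₃ ⟨g₁, e₁⟩ ⟨g₂, e₂⟩ ⟨g₃, e₃⟩
  have h12 := hc s t₁ t₂ g₁ g₂
  have h13 := hc s t₁ t₃ g₁ g₃
  have h23 := hc s t₂ t₃ g₂ g₃
  grind

/-- Extending an acyclic edge coloring of `G` minus a vertex `v` to `G`. -/
theorem isAcyclicEdgeColoring_of_deleteIncidenceSet {v : V}
    (h : IsAcyclicEdgeColoring (G.deleteIncidenceSet v) c)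
    (hinj : ∀ s t, G.Adj v s → G.Adj v t → s ≠ t → c s(v, s) ≠ c s(v, t))
    (hmiss : ∀ s, G.Adj v s → ¬ ColorAt (G.deleteIncidenceSet v) c s (c s(v, s)))
    (hreach : ∀ s t, G.Adj v s → G.Adj v t → s ≠ t →
      ¬ (colorSubgraph (G.deleteIncidenceSet v) c (c s(v, s)) (c s(v, t))).Reachable s t) :
    IsAcyclicEdgeColoring G c := by
  rw [isAcyclicEdgeColoring_iff] at h ⊢
  obtain ⟨hp, hac⟩ := h
  constructor
  · rw [isProperEdgeColoring_iff] at hp ⊢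
    intro s t t' ht ht' hc
    by_contra hne
    by_cases hs : s = v
    · subst hs
      exact hinj t t' ht ht' hne hc
    by_cases htv : t = v
    · subst htv
      refine hmiss s ht.symm ⟨t', deleteIncidenceSet_adj.2 ⟨ht', hs, Ne.symm hne⟩, ?_⟩
      rw [← hc, Sym2.eq_swap]
    by_cases htv' : t' = v
    · subst htv'
      refine hmiss s ht'.symm ⟨t, deleteIncidenceSet_adj.2 ⟨ht, hs, hne⟩, ?_⟩
      rw [hc, Sym2.eq_swap]
    exact hne (hp s t t' (deleteIncidenceSet_adj.2 ⟨ht, hs, htv⟩)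
      (deleteIncidenceSet_adj.2 ⟨ht', hs, htv'⟩) hc)
  · intro a b
    have hex : ∀ a, ∃ s, (s ≠ v → G.Adj v s ∧ c s(v, s) = a) ∧
        ∀ w, G.Adj v w → c s(v, w) = a → w = s := by
      intro a
      by_cases ha : ∃ s, G.Adj v s ∧ c s(v, s) = a
      · obtain ⟨s, hs, rfl⟩ := ha
        exact ⟨s, fun _ => ⟨hs, rfl⟩, fun w hw hc => by
          by_contra hne
          exact hinj w s hw hs hne hc⟩
      · exact ⟨v, fun h => absurd rfl h, fun w hw hc => absurd ⟨w, hw, hc⟩ ha⟩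
    obtain ⟨s, hs, hs'⟩ := hex a
    obtain ⟨t, ht, ht'⟩ := hex b
    refine (isAcyclic_sup_edge_sup_edge (v := v) (s := s) (t := t) (hac a b) ?_ ?_).anti ?_
    · rintro w ⟨hw, -⟩
      exact (deleteIncidenceSet_adj.1 hw).2.1 rfl
    · intro hsv htv hst
      obtain ⟨gs, rfl⟩ := hs hsv
      obtain ⟨gt, rfl⟩ := ht htv
      exact hreach s t gs gt hst
    · have hv : ∀ w, G.Adj v w → (c s(v, w) = a ∨ c s(v, w) = b) → w = s ∨ w = t :=
        fun w hw hc => hc.imp (hs' w hw) (ht' w hw)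
      rintro w w' ⟨hw, hc⟩
      simp only [sup_adj, edge_adj]
      by_cases h₁ : w = v
      · subst h₁
        have := hv w' hw hc
        have := hw.ne
        tauto
      by_cases h₂ : w' = v
      · subst h₂
        have := hv w hw.symm (by rwa [Sym2.eq_swap])
        tauto
      exact .inl (.inl ⟨deleteIncidenceSet_adj.2 ⟨hw, h₁, h₂⟩, hc⟩)

/-- Two edges at `v` of an acyclic edge coloring are not joined by a two-colored path
avoiding `v`. -/
theorem IsAcyclicEdgeColoring.not_reachable {v x y : V} (h : IsAcyclicEdgeColoring G c)
    (hx : G.Adj v x) (hy : G.Adj v y) (hxy : x ≠ y) :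
    ¬ (colorSubgraph (G.deleteIncidenceSet v) c (c s(v, x)) (c s(v, y))).Reachable x y := by
  intro hr
  have hac := (isAcyclicEdgeColoring_iff.1 h).2 (c s(v, x)) (c s(v, y))
  have hb := isAcyclic_iff_forall_adj_isBridge.1 hac (v := v) (w := x) ⟨hx, .inl rfl⟩
  rw [isBridge_iff] at hb
  refine hb (Reachable.trans (v := y) (Adj.reachable ?_) (hr.symm.mono ?_))
  · simp only [deleteEdges_adj, Set.mem_singleton_iff]
    exact ⟨⟨hy, .inr rfl⟩, mt Sym2.congr_right.1 hxy.symm⟩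
  · rintro s t ⟨hst, hc⟩
    rw [deleteIncidenceSet_adj] at hst
    simp only [deleteEdges_adj, Set.mem_singleton_iff]
    refine ⟨⟨hst.1, hc⟩, ?_⟩
    rw [Sym2.eq_iff]
    tauto

end Coloring

/-- The set of colors appearing at `s`. -/
noncomputable def colorsAt {V α : Type*} [Fintype α] (G : SimpleGraph V) (c : Sym2 V → α)
    (s : V) : Finset α :=
  open Classical in Finset.univ.filter (ColorAt G c s)

theorem mem_colorsAt {V α : Type*} [Fintype α] {G : SimpleGraph V} {c : Sym2 V → α} {s : V}
    {a : α} : a ∈ colorsAt G c s ↔ ColorAt G c s a := by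
  classical
  simp [colorsAt]

theorem card_colorsAt_deleteIncidenceSet_lt {V α : Type*} [Fintype V] [Fintype α]
    {G : SimpleGraph V} [DecidableRel G.Adj] {c : Sym2 V → α} {v s : V} (h : G.Adj v s) :
    (colorsAt (G.deleteIncidenceSet v) c s).card < G.degree s := by
  classical
  have hsub : colorsAt (G.deleteIncidenceSet v) c s ⊆
      ((G.neighborFinset s).erase v).image fun t => c s(s, t) := by
    intro a ha
    obtain ⟨t, ht, rfl⟩ := mem_colorsAt.1 ha
    rw [deleteIncidenceSet_adj] at ht
    exact Finset.mem_image_of_mem _ (by simp [ht])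
  refine ((Finset.card_le_card hsub).trans Finset.card_image_le).trans_lt ?_
  exact Finset.card_erase_lt_of_mem (by simpa using h.symm)

section Kempe

variable {V α : Type*} [Fintype α] {H : SimpleGraph V} {c : Sym2 V → α}
  {u x y : V}

/-- The key recoloring argument when exactly one of the two colors `q`, `r` assigned to the edges
from the deleted vertex to `x` and `y` appears at `u`. -/
theorem false_of_mem_of_notMem (hc : IsProperEdgeColoring H c)
    (hux : u ≠ x) (huy : u ≠ y) (hxy : x ≠ y) {D : ℕ} (hD : 2 < D)
    (hu : (colorsAt H c u).card + D ≤ Fintype.card α)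
    (hx : (colorsAt H c x).card < D) (hy : (colorsAt H c y).card < D)
    (hstar : ∀ p q r, p ∉ colorsAt H c u → q ∉ colorsAt H c x → r ∉ colorsAt H c y →
      p ≠ q → p ≠ r → q ≠ r → (colorSubgraph H c p q).Reachable u x ∨
        (colorSubgraph H c p r).Reachable u y ∨ (colorSubgraph H c q r).Reachable x y)
    {q r : α} (hqx : q ∉ colorsAt H c x) (hry : r ∉ colorsAt H c y)
    (hqu : q ∈ colorsAt H c u) (hru : r ∉ colorsAt H c u)
    (hqr : ¬ (colorSubgraph H c q r).Reachable x y) : False := by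
  classical
  have hmem : ∀ {s t a b}, s ≠ t → (colorSubgraph H c a b).Reachable s t →
      a ∉ colorsAt H c s → b ∈ colorsAt H c s := by
    intro s t a b hst h ha
    rw [mem_colorsAt] at ha ⊢
    exact colorAt_of_reachable hst h ha
  have hthree : ∀ {a b}, (a ∉ colorsAt H c u ∨ b ∉ colorsAt H c u) →
      (a ∉ colorsAt H c x ∨ b ∉ colorsAt H c x) → (a ∉ colorsAt H c y ∨ b ∉ colorsAt H c y) →
      (colorSubgraph H c a b).Reachable u x → ¬ (colorSubgraph H c a b).Reachable u y := by
    intro a b h₁ h₂ h₃ h₄ h₅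
    simp only [mem_colorsAt] at h₁ h₂ h₃
    exact hxy (eq_of_reachable_of_not_colorAt hc h₁ h₂ h₃ hux huy h₄ h₅)
  have hne : q ≠ r := fun h => hru (h ▸ hqu)
  set C := (insert r (colorsAt H c u))ᶜ with hC
  have hCmem : ∀ {a}, a ∈ C ↔ a ≠ r ∧ a ∉ colorsAt H c u := by simp [hC]
  have hCcard : D ≤ C.card + 1 := by
    rw [hC, Finset.card_compl, Finset.card_insert_of_notMem hru]
    omega
  have hchain : ∀ a ∈ C, (colorSubgraph H c a q).Reachable u x := by
    intro a ha
    rw [hCmem] at ha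
    rcases hstar a q r ha.2 hqx hry (fun h => ha.2 (h ▸ hqu)) ha.1 hne with h | h | h
    · exact h
    · exact absurd (hmem huy h ha.2) hru
    · exact absurd h hqr
  have hCX : C = colorsAt H c x := by
    refine Finset.eq_of_subset_of_card_le (fun a ha => ?_) (by omega)
    refine hmem hux.symm (a := q) ?_ hqx
    rw [colorSubgraph_comm]
    exact (hchain a ha).symm
  have hrx : r ∉ colorsAt H c x := by
    rw [← hCX, hCmem]
    tauto
  by_cases hCY : C ⊆ colorsAt H c y
  · have hCY' : C = colorsAt H c y := Finset.eq_of_subset_of_card_le hCY (by omega)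
    have hqy : q ∉ colorsAt H c y := by
      rw [← hCY', hCmem]
      tauto
    obtain ⟨a, ha⟩ : C.Nonempty := Finset.card_pos.1 (by omega)
    have ha' := hCmem.1 ha
    rcases hstar a r q ha'.2 hrx hqy ha'.1 (fun h => ha'.2 (h ▸ hqu)) hne.symm with h | h | h
    · exact hru (hmem hux h ha'.2)
    · exact hthree (.inl ha'.2) (.inr hqx) (.inr hqy) (hchain a ha) h
    · exact hqx (hmem hxy h hrx)
  · obtain ⟨a, ha, hay⟩ := Finset.not_subset.1 hCY
    have ha' := hCmem.1 ha
    rcases hstar r q a hru hqx hay hne.symm ha'.1.symm (fun h => ha'.2 (h ▸ hqu)) with h | h | h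
    · rw [colorSubgraph_comm] at h
      exact hrx (hmem hux.symm h.symm hqx)
    · exact ha'.2 (hmem huy h hru)
    · rw [colorSubgraph_comm] at h
      exact hthree (.inl ha'.2) (.inr hqx) (.inl hay) (hchain a ha) ((hchain a ha).trans h)

theorem false_of_forall_reachable (hc : IsProperEdgeColoring H c)
    (hux : u ≠ x) (huy : u ≠ y) (hxy : x ≠ y) {D : ℕ} (hD : 2 < D)
    (hu : (colorsAt H c u).card + D ≤ Fintype.card α)
    (hx : (colorsAt H c x).card < D) (hy : (colorsAt H c y).card < D)
    (hstar : ∀ p q r, p ∉ colorsAt H c u → q ∉ colorsAt H c x → r ∉ colorsAt H c y →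
      p ≠ q → p ≠ r → q ≠ r → (colorSubgraph H c p q).Reachable u x ∨
        (colorSubgraph H c p r).Reachable u y ∨ (colorSubgraph H c q r).Reachable x y)
    {q r : α} (hqx : q ∉ colorsAt H c x) (hry : r ∉ colorsAt H c y) (hne : q ≠ r)
    (hqr : ¬ (colorSubgraph H c q r).Reachable x y) : False := by
  classical
  have hmem : ∀ {s t a b}, s ≠ t → (colorSubgraph H c a b).Reachable s t →
      a ∉ colorsAt H c s → b ∈ colorsAt H c s := by
    intro s t a b hst h ha
    rw [mem_colorsAt] at ha ⊢
    exact colorAt_of_reachable hst h ha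
  have hstar' : ∀ p q r, p ∉ colorsAt H c u → q ∉ colorsAt H c y → r ∉ colorsAt H c x →
      p ≠ q → p ≠ r → q ≠ r → (colorSubgraph H c p q).Reachable u y ∨
        (colorSubgraph H c p r).Reachable u x ∨ (colorSubgraph H c q r).Reachable y x := by
    intro p q r hp hq hr h₁ h₂ h₃
    rw [colorSubgraph_comm (a := q), reachable_comm (u := y)]
    have := hstar p r q hp hr hq h₂ h₁ h₃.symm
    tauto
  have hswap : ∀ {q r}, ¬ (colorSubgraph H c q r).Reachable x y →
      ¬ (colorSubgraph H c r q).Reachable y x := by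
    intro q r h
    rwa [colorSubgraph_comm, reachable_comm]
  by_cases hqu : q ∈ colorsAt H c u
  · by_cases hru : r ∈ colorsAt H c u
    · obtain ⟨a, ha⟩ : ∃ a, a ∉ colorsAt H c u ∪ colorsAt H c x := by
        by_contra! h
        have h₁ := Finset.card_le_card (fun a _ => h a : Finset.univ ⊆ _)
        have h₂ := Finset.card_union_le (colorsAt H c u) (colorsAt H c x)
        rw [Finset.card_univ] at h₁
        omega
      rw [Finset.mem_union, not_or] at ha
      have har : a ≠ r := fun h => ha.1 (h ▸ hru)
      have hchain : (colorSubgraph H c a r).Reachable u y := by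
        rcases hstar a q r ha.1 hqx hry (fun h => ha.1 (h ▸ hqu)) har hne with h | h | h
        · rw [colorSubgraph_comm] at h
          exact absurd (hmem hux.symm h.symm hqx) ha.2
        · exact h
        · exact absurd h hqr
      refine false_of_mem_of_notMem hc huy hux hxy.symm hD hu hy hx hstar' hry ha.2 hru ha.1
        (hswap fun h => ?_)
      have h₁ := ha.1
      have h₂ := ha.2
      rw [mem_colorsAt] at h₁ h₂ hry
      exact hxy (eq_of_reachable_of_not_colorAt hc (.inl h₁) (.inl h₂) (.inr hry) hux huy
        (hchain.trans h.symm) hchain)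
    · exact false_of_mem_of_notMem hc hux huy hxy hD hu hx hy hstar hqx hry hqu hru hqr
  · by_cases hru : r ∈ colorsAt H c u
    · exact false_of_mem_of_notMem hc huy hux hxy.symm hD hu hy hx hstar' hry hqx hru hqu
        (hswap hqr)
    · obtain ⟨p, hp⟩ : ∃ p, p ∉ insert q (insert r (colorsAt H c u)) := by
        by_contra! h
        have h₁ := Finset.card_le_card (fun a _ => h a : Finset.univ ⊆ _)
        have h₂ := Finset.card_insert_le q (insert r (colorsAt H c u))
        have h₃ := Finset.card_insert_le r (colorsAt H c u)
        rw [Finset.card_univ] at h₁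
        omega
      simp only [Finset.mem_insert, not_or] at hp
      rcases hstar p q r hp.2.2 hqx hry hp.1 hp.2.1 hne with h | h | h
      · exact hqu (hmem hux h hp.2.2)
      · exact hru (hmem huy h hp.2.2)
      · exact hqr h

end Kempe

theorem stmt10 {V : Type*} [Fintype V] (G : SimpleGraph V) [DecidableRel G.Adj]
    (k : ℕ) (hG : IsAcyclicallyEdgeCritical G k) (hk : G.maxDegree + 2 ≤ k)
    (v : V) (hv : G.degree v = 3) :
    ∀ u : V, G.Adj v u → k - G.maxDegree + 2 ≤ G.degree u := by
  classical
  intro u hvu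
  by_contra! hdeg
  obtain ⟨x, y, hxy, hN⟩ : ∃ x y, x ≠ y ∧ (G.neighborFinset v).erase u = {x, y} := by
    rw [← Finset.card_eq_two, Finset.card_erase_of_mem (by simpa using hvu),
      card_neighborFinset_eq_degree, hv]
  have hNv : ∀ w, G.Adj v w ↔ w = u ∨ w = x ∨ w = y := by
    intro w
    have := Finset.ext_iff.1 hN w
    simp only [Finset.mem_erase, mem_neighborFinset, Finset.mem_insert,
      Finset.mem_singleton] at this
    by_cases h : w = u
    · simp [h, hvu]
    · tauto
  have hux : u ≠ x := by
    rintro rfl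
    exact Finset.notMem_erase _ _ (hN ▸ Finset.mem_insert_self _ _)
  have huy : u ≠ y := by
    rintro rfl
    exact Finset.notMem_erase u (G.neighborFinset v) (by simp [hN])
  have hvx : G.Adj v x := (hNv x).2 (by simp)
  have hvy : G.Adj v y := (hNv y).2 (by simp)
  obtain ⟨c, hc⟩ := hG.2 (G.deleteEdges {s(v, u)}) (by
    refine lt_of_le_of_ne (deleteEdges_le _) fun h => ?_
    have := h ▸ hvu
    simp at this)
  have hx₁ : (G.deleteEdges {s(v, u)}).Adj v x := by simp [hvx, hux.symm, hvu.ne]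
  have hy₁ : (G.deleteEdges {s(v, u)}).Adj v y := by simp [hvy, huy.symm, hvu.ne]
  have hH : (G.deleteEdges {s(v, u)}).deleteIncidenceSet v = G.deleteIncidenceSet v := by
    ext s t
    simp only [deleteIncidenceSet_adj, deleteEdges_adj, Set.mem_singleton_iff, Sym2.eq_iff]
    tauto
  have hqr := hc.not_reachable hx₁ hy₁ hxy
  rw [hH] at hqr
  have hc₀ : IsAcyclicEdgeColoring (G.deleteIncidenceSet v) c :=
    hc.mono (hH ▸ deleteIncidenceSet_le _ _)
  have hprop := isProperEdgeColoring_iff.1 hc.1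
  have hmiss : ∀ w, (G.deleteEdges {s(v, u)}).Adj v w →
      c s(v, w) ∉ colorsAt (G.deleteIncidenceSet v) c w := by
    intro w hw hmem
    obtain ⟨t, ht, hct⟩ := mem_colorsAt.1 hmem
    rw [← hH, deleteIncidenceSet_adj] at ht
    exact ht.2.2 (hprop w t v ht.1 hw.symm (by rw [hct, Sym2.eq_swap]))
  have hD : 2 < G.maxDegree := by
    have := G.degree_le_maxDegree v
    omega
  refine false_of_forall_reachable hc₀.1 hux huy hxy hD ?_
    ((card_colorsAt_deleteIncidenceSet_lt hvx).trans_le (G.degree_le_maxDegree x))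
    ((card_colorsAt_deleteIncidenceSet_lt hvy).trans_le (G.degree_le_maxDegree y)) ?_
    (hmiss x hx₁) (hmiss y hy₁) (fun h => hxy (hprop v x y hx₁ hy₁ h)) hqr
  · have := card_colorsAt_deleteIncidenceSet_lt (c := c) hvu
    rw [Fintype.card_fin]
    omega
  · intro p q r hp hq hr hpq hpr hqr'
    by_contra! hnot
    obtain ⟨n₁, n₂, n₃⟩ := hnot
    set c' : Sym2 V → Fin k := fun e =>
      if e = s(v, u) then p else if e = s(v, x) then q else if e = s(v, y) then r else c e
      with hc'
    have hcu : c' s(v, u) = p := by simp [hc']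
    have hcx : c' s(v, x) = q := by simp [hc', hux.symm, hvu.ne]
    have hcy : c' s(v, y) = r := by simp [hc', huy.symm, hxy.symm, hvu.ne, hvx.ne]
    have hcongr : ∀ e ∈ (G.deleteIncidenceSet v).edgeSet, c' e = c e := by
      intro e he
      have hne : ∀ w, e ≠ s(v, w) := by
        rintro w rfl
        exact (deleteIncidenceSet_adj.1 he).2.1 rfl
      simp [hc', hne]
    have hcolor : ∀ s a, ColorAt (G.deleteIncidenceSet v) c' s a ↔
        a ∈ colorsAt (G.deleteIncidenceSet v) c s := by
      intro s a
      rw [mem_colorsAt]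
      exact exists_congr fun t => and_congr_right fun h => by rw [hcongr _ h]
    refine hG.1 ⟨c', isAcyclicEdgeColoring_of_deleteIncidenceSet (hc₀.congr hcongr) ?_ ?_ ?_⟩
    · intro s t hs ht hst
      rcases (hNv s).1 hs with rfl | rfl | rfl <;> rcases (hNv t).1 ht with rfl | rfl | rfl <;>
        simp only [hcu, hcx, hcy] <;>
        first
        | exact absurd rfl hst
        | assumption
        | (apply Ne.symm; assumption)
    · intro s hs
      rw [hcolor]
      rcases (hNv s).1 hs with rfl | rfl | rfl
      · rwa [hcu]
      · rwa [hcx]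
      · rwa [hcy]
    · intro s t hs ht hst
      rw [colorSubgraph_congr hcongr]
      rcases (hNv s).1 hs with rfl | rfl | rfl <;> rcases (hNv t).1 ht with rfl | rfl | rfl <;>
        first
        | exact absurd rfl hst
        | (simp only [hcu, hcx, hcy]; assumption)
        | (simp only [hcu, hcx, hcy]; rw [colorSubgraph_comm, reachable_comm]; assumption)
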